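/- arXiv:1412.4992 — 14 statements merged into one kernel-verified Lean document; each statement's English description precedes it below -/
import Mathlib

section
/- Let I and J be ℝ-linear endomorphisms of E that anti-commute, i.e. I ∘ J = −J ∘ I. Then for all X, Y ∈ E: 2·T_b(I∘J)(X,Y) = T_b I(J X, J Y) − J(T_b I(J X, Y) + T_b I(X, J Y)) − J²(T_b I(X,Y)) + T_b J(I X, I Y) − I(T_b J(I X, Y) + T_b J(X, I Y)) − I²(T_b J(X,Y)). In particular, if T_b I = 0 and T_b J = 0, then T_b(I∘J) = 0. -/
variable {E : Type*} [AddCommGroup E] [Module ℝ E]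

/-- The deformed bracket `b_I(X,Y) = b(I X, Y) + b(X, I Y) - I (b(X,Y))`. -/
noncomputable def deform (b : E →ₗ[ℝ] E →ₗ[ℝ] E) (I : E →ₗ[ℝ] E) :
    E →ₗ[ℝ] E →ₗ[ℝ] E :=
  b ∘ₗ I + LinearMap.compl₂ b I - LinearMap.compr₂ b I

/-- The Nijenhuis torsion of `I` with respect to `b`:
`T_b I (X,Y) = b(I X, I Y) - I (b_I(X,Y))`. -/
noncomputable def torsion (b : E →ₗ[ℝ] E →ₗ[ℝ] E) (I : E →ₗ[ℝ] E) (X Y : E) : E :=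
  b (I X) (I Y) - I (deform b I X Y)

theorem statement0 (b : E →ₗ[ℝ] E →ₗ[ℝ] E) (I J : E →ₗ[ℝ] E)
    (h : I ∘ₗ J = -(J ∘ₗ I)) :
    (∀ X Y : E,
      (2 : ℝ) • torsion b (I ∘ₗ J) X Y =
        torsion b I (J X) (J Y) - J (torsion b I (J X) Y + torsion b I X (J Y))
          - (J ∘ₗ J) (torsion b I X Y)
        + (torsion b J (I X) (I Y) - I (torsion b J (I X) Y + torsion b J X (I Y))
          - (I ∘ₗ I) (torsion b J X Y))) ∧
    ((∀ X Y : E, torsion b I X Y = 0) → (∀ X Y : E, torsion b J X Y = 0) →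
      ∀ X Y : E, torsion b (I ∘ₗ J) X Y = 0) := by
  have hJI (x : E) : J (I x) = -I (J x) := by
    simpa using (congrArg Neg.neg (LinearMap.congr_fun h x)).symm
  have key (X Y : E) :
      (2 : ℝ) • torsion b (I ∘ₗ J) X Y =
        torsion b I (J X) (J Y) - J (torsion b I (J X) Y + torsion b I X (J Y))
          - (J ∘ₗ J) (torsion b I X Y)
        + (torsion b J (I X) (I Y) - I (torsion b J (I X) Y + torsion b J X (I Y))
          - (I ∘ₗ I) (torsion b J X Y)) := by
    simp only [torsion, deform, LinearMap.sub_apply, LinearMap.add_apply, LinearMap.comp_apply,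
      LinearMap.compl₂_apply, LinearMap.compr₂_apply, map_add, map_sub, map_neg,
      LinearMap.neg_apply, hJI]
    module
  refine ⟨key, fun hI hJ X Y => ?_⟩
  have hkey := key X Y
  simp only [hI, hJ, map_zero, add_zero, sub_zero] at hkey
  exact (smul_eq_zero.mp hkey).resolve_left two_ne_zero
end

section
/- Let I be an ℝ-linear endomorphism of E such that I ∘ I = λ·id_E for some real number λ ≠ 0. Then the Nijenhuis torsion of I with respect to b vanishes if and only if the Nijenhuis torsion of I with respect to the deformed bracket b_I vanishes: T_b I = 0 ⟺ T_{b_I} I = 0. -/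
variable {E : Type*} [AddCommGroup E] [Module ℝ E]

/-- The concomitant `C_b(I,J)(X,Y) = b_{I,J}(X,Y) + b_{J,I}(X,Y)`. -/
noncomputable def concomitant (b : E →ₗ[ℝ] E →ₗ[ℝ] E) (I J : E →ₗ[ℝ] E) (X Y : E) : E :=
  deform (deform b I) J X Y + deform (deform b J) I X Y

theorem deform_apply (b : E →ₗ[ℝ] E →ₗ[ℝ] E) (I : E →ₗ[ℝ] E) (X Y : E) :
    deform b I X Y = b (I X) Y + b X (I Y) - I (b X Y) := by
  simp [deform]

/-- If `I ∘ I` is a scalar, then `T_{b_I} I = -3 I (T_b I)`. -/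
theorem torsion_deform (b : E →ₗ[ℝ] E →ₗ[ℝ] E) {I : E →ₗ[ℝ] E} {l : ℝ}
    (hI : ∀ X, I (I X) = l • X) (X Y : E) :
    torsion (deform b I) I X Y = (-3 : ℝ) • I (torsion b I X Y) := by
  simp only [torsion, deform_apply, map_add, map_sub, map_smul, LinearMap.smul_apply, hI]
  module

theorem statement1 (b : E →ₗ[ℝ] E →ₗ[ℝ] E) (I : E →ₗ[ℝ] E) (l : ℝ) (hl : l ≠ 0)
    (hI : I ∘ₗ I = l • (LinearMap.id : E →ₗ[ℝ] E)) :
    (∀ X Y : E, torsion b I X Y = 0) ↔ (∀ X Y : E, torsion (deform b I) I X Y = 0) := by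
  have hI' : ∀ X, I (I X) = l • X := fun X => LinearMap.congr_fun hI X
  have hinj (X : E) (hX : I X = 0) : X = 0 := by
    have h := hI' X
    rw [hX, map_zero] at h
    exact (smul_eq_zero.mp h.symm).resolve_left hl
  simp only [torsion_deform b hI', smul_eq_zero, neg_eq_zero, OfNat.ofNat_ne_zero, false_or]
  exact forall₂_congr fun X Y => ⟨fun h => by rw [h, map_zero], hinj _⟩
end

section
/- Let I and J be ℝ-linear endomorphisms of E such that I ∘ J = −J ∘ I, the concomitant C_b(I,J) vanishes identically, and I ∘ I = λ·id_E for some real number λ ≠ 0. Then T_b J = 0 if and only if T_{b_I} J = 0, where T_{b_I} denotes Nijenhuis torsion with respect to the deformed bracket b_I. -/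
variable {E : Type*} [AddCommGroup E] [Module ℝ E]

/-- For anticommuting `I` and `J`, the torsion of `J` with respect to `b_I` is determined by the
torsion of `J` with respect to `b` and the concomitant of `I` and `J`. -/
theorem torsion_deform_of_anticomm (b : E →ₗ[ℝ] E →ₗ[ℝ] E) (I J : E →ₗ[ℝ] E)
    (hanti : ∀ x, I (J x) = -J (I x)) (X Y : E) :
    torsion (deform b I) J X Y =
      -(torsion b J (I X) Y + torsion b J X (I Y) + I (torsion b J X Y))
        - J (concomitant b I J X Y) := by
  simp only [torsion, concomitant, deform, LinearMap.add_apply, LinearMap.sub_apply,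
    LinearMap.comp_apply, LinearMap.compl₂_apply, LinearMap.compr₂_apply, map_add, map_sub,
    map_neg, LinearMap.neg_apply, hanti]
  abel

/-- If `I² = l` with `l ≠ 0`, then the operator `T ↦ T(I ·, ·) + T(·, I ·) + I T(·, ·)` has
trivial kernel. -/
theorem eq_zero_of_add_add_eq_zero {T : E → E → E} {I : E →ₗ[ℝ] E} {l : ℝ} (hl : l ≠ 0)
    (hI : ∀ x, I (I x) = l • x) (hsmul_left : ∀ (c : ℝ) X Y, T (c • X) Y = c • T X Y)
    (hsmul_right : ∀ (c : ℝ) X Y, T X (c • Y) = c • T X Y)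
    (h : ∀ X Y, T (I X) Y + T X (I Y) + I (T X Y) = 0) (X Y : E) : T X Y = 0 := by
  have key : ∀ X Y, l • T X Y + (2 : ℝ) • T (I X) (I Y) = 0 := fun X Y => by
    have h₁ := h (I X) Y
    have h₂ := h X (I Y)
    have h₃ := congrArg I (h X Y)
    simp only [hI, hsmul_left, hsmul_right, map_add, map_zero] at h₁ h₂ h₃
    linear_combination (norm := module) h₁ + h₂ - h₃
  have h₁ := key X Y
  have h₂ := key (I X) (I Y)
  simp only [hI, hsmul_left, hsmul_right] at h₂
  have h₃ : (3 * l ^ 2) • T X Y = 0 := by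
    linear_combination (norm := module) (2 : ℝ) • h₂ - l • h₁
  exact (smul_eq_zero.mp h₃).resolve_left (by positivity)

theorem statement2 (b : E →ₗ[ℝ] E →ₗ[ℝ] E) (I J : E →ₗ[ℝ] E)
    (hanti : I ∘ₗ J = -(J ∘ₗ I))
    (hC : ∀ X Y : E, concomitant b I J X Y = 0)
    (l : ℝ) (hl : l ≠ 0)
    (hI : I ∘ₗ I = l • (LinearMap.id : E →ₗ[ℝ] E)) :
    (∀ X Y : E, torsion b J X Y = 0) ↔ (∀ X Y : E, torsion (deform b I) J X Y = 0) := by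
  have hanti' : ∀ x, I (J x) = -J (I x) := fun x => by simpa using LinearMap.congr_fun hanti x
  have hI' : ∀ x, I (I x) = l • x := fun x => by simpa using LinearMap.congr_fun hI x
  have htorsion : ∀ X Y, torsion (deform b I) J X Y =
      -(torsion b J (I X) Y + torsion b J X (I Y) + I (torsion b J X Y)) := fun X Y => by
    rw [torsion_deform_of_anticomm b I J hanti', hC, map_zero, sub_zero]
  constructor
  · intro h X Y
    simp [htorsion, h]
  · intro h
    refine eq_zero_of_add_add_eq_zero hl hI' ?_ ?_
      fun X Y => neg_eq_zero.mp ((htorsion X Y).symm.trans (h X Y))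
    all_goals
      intro c X Y
      simp [torsion, deform, smul_sub, smul_add]
end

section
/- Let I and J be ℝ-linear endomorphisms of E such that I ∘ J = −J ∘ I and both Nijenhuis torsions vanish: T_b I = 0 and T_b J = 0. Then for all X, Y ∈ E, C_b(I, I∘J)(X,Y) = I(C_b(I,J)(X,Y)). -/
variable {E : Type*} [AddCommGroup E] [Module ℝ E]

theorem concomitant_of_anticomm (b : E →ₗ[ℝ] E →ₗ[ℝ] E) {I J : E →ₗ[ℝ] E}
    (h : ∀ Z : E, I (J Z) = -J (I Z)) (X Y : E) :
    concomitant b I J X Y =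
      (2 : ℝ) • (b (J X) (I Y) + b (I X) (J Y) - I (b (J X) Y) - I (b X (J Y))
        - J (b (I X) Y) - J (b X (I Y))) := by
  simp only [concomitant, deform, LinearMap.add_apply, LinearMap.sub_apply, LinearMap.comp_apply,
    LinearMap.compl₂_apply, LinearMap.compr₂_apply, map_add, map_sub, map_neg,
    LinearMap.neg_apply, h]
  module

theorem apply_apply_eq_of_torsion_eq_zero {b : E →ₗ[ℝ] E →ₗ[ℝ] E} {I : E →ₗ[ℝ] E} {X Y : E}
    (h : torsion b I X Y = 0) :
    b (I X) (I Y) = I (b (I X) Y) + I (b X (I Y)) - I (I (b X Y)) := by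
  simpa [torsion, deform, sub_eq_zero] using h

theorem statement3 (b : E →ₗ[ℝ] E →ₗ[ℝ] E) (I J : E →ₗ[ℝ] E)
    (hanti : I ∘ₗ J = -(J ∘ₗ I))
    (hI : ∀ X Y : E, torsion b I X Y = 0)
    (hJ : ∀ X Y : E, torsion b J X Y = 0) :
    ∀ X Y : E, concomitant b I (I ∘ₗ J) X Y = I (concomitant b I J X Y) := by
  intro X Y
  have h (Z : E) : I (J Z) = -J (I Z) := LinearMap.congr_fun hanti Z
  have hK (Z : E) : I ((I ∘ₗ J) Z) = -(I ∘ₗ J) (I Z) := by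
    simp only [LinearMap.comp_apply, h, map_neg]
  rw [concomitant_of_anticomm b hK, concomitant_of_anticomm b h]
  simp only [LinearMap.comp_apply, apply_apply_eq_of_torsion_eq_zero (hI (J X) Y),
    apply_apply_eq_of_torsion_eq_zero (hI X (J Y)), map_smul, map_add, map_sub]
  module
end

section
/- Let I and J be ℝ-linear endomorphisms of E such that I ∘ J = −J ∘ I, T_b I = 0, T_b J = 0, and moreover I ∘ I = λ_I·id_E and J ∘ J = λ_J·id_E for some real numbers λ_I ≠ 0 and λ_J ≠ 0. Then the concomitant of I and J vanishes identically: C_b(I,J)(X,Y) = 0 for all X, Y ∈ E. -/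
variable {E : Type*} [AddCommGroup E] [Module ℝ E]

theorem statement4 (b : E →ₗ[ℝ] E →ₗ[ℝ] E) (I J : E →ₗ[ℝ] E)
    (hanti : I ∘ₗ J = -(J ∘ₗ I))
    (hI : ∀ X Y : E, torsion b I X Y = 0)
    (hJ : ∀ X Y : E, torsion b J X Y = 0)
    (lI lJ : ℝ) (hlI : lI ≠ 0) (hlJ : lJ ≠ 0)
    (hI2 : I ∘ₗ I = lI • (LinearMap.id : E →ₗ[ℝ] E))
    (hJ2 : J ∘ₗ J = lJ • (LinearMap.id : E →ₗ[ℝ] E)) :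
    ∀ X Y : E, concomitant b I J X Y = 0 := by
  intro X Y
  have hIJ : ∀ Z, I (J Z) = -J (I Z) := fun Z => LinearMap.congr_fun hanti Z
  have hII : ∀ Z, I (I Z) = lI • Z := fun Z => LinearMap.congr_fun hI2 Z
  have hJJ : ∀ Z, J (J Z) = lJ • Z := fun Z => LinearMap.congr_fun hJ2 Z
  have key : (lI * lJ ^ 2) • concomitant b I J X Y =
      lJ ^ 2 • (torsion b I (I (J X)) Y + torsion b I X (I (J Y)) - I (J (torsion b I X Y)))
      + lI • J (torsion b J (I (J X)) (J Y)) - lJ • J (torsion b I (I (J X)) (J Y))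
      - (lI * lJ) • (J (torsion b J X (I Y)) - I (J (torsion b J X Y)))
      + lJ • I (J (torsion b J (I X) (I Y))) := by
    simp only [concomitant, torsion, deform, LinearMap.add_apply, LinearMap.sub_apply,
      LinearMap.comp_apply, LinearMap.compl₂_apply, LinearMap.compr₂_apply, map_add, map_sub,
      map_neg, map_smul, LinearMap.neg_apply, LinearMap.smul_apply, hIJ, hII, hJJ]
    module
  simp only [hI, hJ, map_zero, smul_zero, add_zero, sub_zero] at key
  exact (smul_eq_zero.mp key).resolve_left (mul_ne_zero hlI (pow_ne_zero 2 hlJ))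
end

section
/- Let (S₁, S₂, S₃) be an ε-hypersymplectic structure on (E, B, b). Then each S_i is a Nijenhuis morphism, i.e. T_b S_i = 0 for i = 1, 2, 3. -/
variable {E : Type*} [AddCommGroup E] [Module ℝ E]

/-- An ε-hypersymplectic structure on `(E, B, b)`: a triple `S i` (indices in `ZMod 3`,
with `3 ≡ 0`) of `B`-skew-symmetric endomorphisms such that `S i ∘ S i = ε i • id`,
`S i ∘ S j = ε₁ε₂ε₃ • (S j ∘ S i)` for `i ≠ j`, and `b_{S i, S i} = ε i • b`. -/
noncomputable def IsEpsHypersymplectic (B : E →ₗ[ℝ] E →ₗ[ℝ] ℝ) (b : E →ₗ[ℝ] E →ₗ[ℝ] E)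
    (ε : ZMod 3 → ℝ) (S : ZMod 3 → E →ₗ[ℝ] E) : Prop :=
  (∀ i, ∀ X Y : E, B (S i X) Y = - B X (S i Y)) ∧
  (∀ i, S i ∘ₗ S i = ε i • (LinearMap.id : E →ₗ[ℝ] E)) ∧
  (∀ i j, i ≠ j → S i ∘ₗ S j = (ε 0 * ε 1 * ε 2) • (S j ∘ₗ S i)) ∧
  (∀ i, deform (deform b (S i)) (S i) = ε i • b)

/-- The transition endomorphisms `T i := ε (i-1) • (S (i-1) ∘ S (i+1))`. -/
noncomputable def transMor (ε : ZMod 3 → ℝ) (S : ZMod 3 → E →ₗ[ℝ] E) (i : ZMod 3) :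
    E →ₗ[ℝ] E :=
  ε (i - 1) • (S (i - 1) ∘ₗ S (i + 1))

/-- The endomorphism `G := S₃ ∘ S₂ ∘ S₁` (with `S₃ = S 0`). -/
noncomputable def metricG (S : ZMod 3 → E →ₗ[ℝ] E) : E →ₗ[ℝ] E :=
  S 0 ∘ₗ S 2 ∘ₗ S 1
/-- For `I ∘ I = c • id`, the twice deformed bracket is `b_{I,I} = 2 T_b I + c b`. -/
theorem deform_deform_eq_torsion {I : E →ₗ[ℝ] E} {c : ℝ}
    (hI : I ∘ₗ I = c • (LinearMap.id : E →ₗ[ℝ] E)) (b : E →ₗ[ℝ] E →ₗ[ℝ] E) (X Y : E) :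
    deform (deform b I) I X Y = (2 : ℝ) • torsion b I X Y + c • b X Y := by
  have hI' (Z : E) : I (I Z) = c • Z := by simpa using LinearMap.congr_fun hI Z
  simp only [torsion, deform_apply, map_add, map_sub, map_smul, LinearMap.smul_apply, hI']
  module

theorem statement5 (B : E →ₗ[ℝ] E →ₗ[ℝ] ℝ) (b : E →ₗ[ℝ] E →ₗ[ℝ] E)
    (ε : ZMod 3 → ℝ) (S : ZMod 3 → E →ₗ[ℝ] E)
    (hε : ∀ i, ε i = 1 ∨ ε i = -1)
    (hBsymm : ∀ X Y : E, B X Y = B Y X)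
    (hBnd : ∀ X : E, (∀ Y : E, B X Y = 0) → X = 0)
    (hS : IsEpsHypersymplectic B b ε S) :
    ∀ i, ∀ X Y : E, torsion b (S i) X Y = 0 := by
  intro i X Y
  obtain ⟨-, hsq, -, hdef⟩ := hS
  have h := deform_deform_eq_torsion (hsq i) b X Y
  rw [hdef i, LinearMap.smul_apply, LinearMap.smul_apply, right_eq_add] at h
  exact (smul_eq_zero.mp h).resolve_left two_ne_zero
end

section
/- Let (S₁, S₂, S₃) be an ε-hypersymplectic structure on (E, B, b). Then the transition endomorphisms T₁, T₂, T₃ satisfy, for all i = 1, 2, 3 (indices modulo 3): (i) B(T_i X, Y) = ε₁ε₂ε₃·B(X, T_i Y) for all X, Y ∈ E; (ii) T_i ∘ T_i = ε_i·id_E; (iii) T_{i−1} ∘ T_{i+1} = ε₁ε₂ε₃·T_{i+1} ∘ T_{i−1} = ε_i·T_i; (iv) T₃ ∘ T₂ ∘ T₁ = ε₁ε₂ε₃·T₁ ∘ T₂ ∘ T₃ = id_E. -/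
variable {E : Type*} [AddCommGroup E] [Module ℝ E]

theorem ZMod.prod_three_cyclic (ε : ZMod 3 → ℝ) (i : ZMod 3) :
    ε 0 * ε 1 * ε 2 = ε (i - 1) * ε i * ε (i + 1) := by
  have h : ∀ j : ZMod 3, j = 0 ∨ j = 1 ∨ j = 2 := by decide
  have h₀ : (0 - 1 : ZMod 3) = 2 := by decide
  have h₁ : (1 + 1 : ZMod 3) = 2 := by decide
  have h₂ : (2 - 1 : ZMod 3) = 1 := by decide
  have h₃ : (2 + 1 : ZMod 3) = 0 := by decide
  rcases h i with rfl | rfl | rfl <;> simp only [h₀, h₁, h₂, h₃, sub_self, zero_add] <;> ring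

namespace IsEpsHypersymplectic

variable {B : E →ₗ[ℝ] E →ₗ[ℝ] ℝ} {b : E →ₗ[ℝ] E →ₗ[ℝ] E}
  {ε : ZMod 3 → ℝ} {S : ZMod 3 → E →ₗ[ℝ] E}

theorem apply_apply_self (hS : IsEpsHypersymplectic B b ε S) (i : ZMod 3) (x : E) :
    S i (S i x) = ε i • x :=
  LinearMap.congr_fun (hS.2.1 i) x

theorem apply_apply_comm (hS : IsEpsHypersymplectic B b ε S) {i j : ZMod 3} (hij : i ≠ j)
    (x : E) : S i (S j x) = (ε 0 * ε 1 * ε 2) • S j (S i x) :=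
  LinearMap.congr_fun (hS.2.2.1 i j hij) x

theorem bilin_transMor (hS : IsEpsHypersymplectic B b ε S) (i : ZMod 3) (X Y : E) :
    B (transMor ε S i X) Y = (ε 0 * ε 1 * ε 2) * B X (transMor ε S i Y) := by
  have hne : i + 1 ≠ i - 1 := by revert i; decide
  simp only [transMor, LinearMap.smul_apply, LinearMap.comp_apply, map_smul, smul_eq_mul, hS.1,
    neg_neg, hS.apply_apply_comm hne]
  ring

theorem transMor_comp_self (hS : IsEpsHypersymplectic B b ε S) (hε : ∀ i, ε i * ε i = 1)
    (i : ZMod 3) : transMor ε S i ∘ₗ transMor ε S i = ε i • (LinearMap.id : E →ₗ[ℝ] E) := by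
  have hne : i + 1 ≠ i - 1 := by revert i; decide
  ext x
  simp only [transMor, LinearMap.smul_apply, LinearMap.comp_apply, map_smul, LinearMap.id_apply,
    hS.apply_apply_comm hne, hS.apply_apply_self, smul_smul]
  congr 1
  rw [ZMod.prod_three_cyclic ε i]
  linear_combination ε i * (ε (i - 1) * ε (i - 1) * ε (i + 1) * ε (i + 1)
    + ε (i + 1) * ε (i + 1)) * hε (i - 1) + ε i * hε (i + 1)

theorem transMor_comp (hS : IsEpsHypersymplectic B b ε S) (hε : ∀ i, ε i * ε i = 1)
    (i : ZMod 3) : transMor ε S (i - 1) ∘ₗ transMor ε S (i + 1) = ε i • transMor ε S i := by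
  have hne : i + 1 ≠ i - 1 := by revert i; decide
  have h₁ : i - 1 - 1 = i + 1 := by revert i; decide
  have h₂ : i + 1 + 1 = i - 1 := by revert i; decide
  ext x
  simp only [transMor, h₁, h₂, sub_add_cancel, add_sub_cancel_right, LinearMap.smul_apply,
    LinearMap.comp_apply, map_smul, hS.apply_apply_comm hne, hS.apply_apply_self, smul_smul]
  congr 1
  rw [ZMod.prod_three_cyclic ε i]
  linear_combination ε i * ε (i - 1) * (ε i * ε i * hε (i + 1) + hε i)

theorem transMor_comp_swap (hS : IsEpsHypersymplectic B b ε S) (hε : ∀ i, ε i * ε i = 1)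
    (i : ZMod 3) : transMor ε S (i - 1) ∘ₗ transMor ε S (i + 1) =
      (ε 0 * ε 1 * ε 2) • (transMor ε S (i + 1) ∘ₗ transMor ε S (i - 1)) := by
  have hne₁ : i ≠ i - 1 := by revert i; decide
  have hne₂ : i ≠ i + 1 := by revert i; decide
  have h₁ : i - 1 - 1 = i + 1 := by revert i; decide
  have h₂ : i + 1 + 1 = i - 1 := by revert i; decide
  rw [hS.transMor_comp hε]
  ext x
  simp only [transMor, h₁, h₂, sub_add_cancel, add_sub_cancel_right, LinearMap.smul_apply,
    LinearMap.comp_apply, map_smul, hS.apply_apply_comm hne₁, hS.apply_apply_comm hne₂,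
    hS.apply_apply_self, smul_smul]
  congr 1
  have hprod : (ε 0 * ε 1 * ε 2) * (ε 0 * ε 1 * ε 2) = 1 := by
    linear_combination (ε 1 * ε 1 * ε 2 * ε 2) * hε 0 + ε 2 * ε 2 * hε 1 + hε 2
  have hcyc := ZMod.prod_three_cyclic ε i
  generalize ε 0 * ε 1 * ε 2 = e at *
  linear_combination (-ε i * ε i * ε (i + 1) * e) * hprod - ε (i + 1) * e * hε i
    - ε (i + 1) * hcyc - ε i * ε (i - 1) * hε (i + 1)

end IsEpsHypersymplectic

theorem statement6 (B : E →ₗ[ℝ] E →ₗ[ℝ] ℝ) (b : E →ₗ[ℝ] E →ₗ[ℝ] E)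
    (ε : ZMod 3 → ℝ) (S : ZMod 3 → E →ₗ[ℝ] E)
    (hε : ∀ i, ε i = 1 ∨ ε i = -1)
    (hBsymm : ∀ X Y : E, B X Y = B Y X)
    (hBnd : ∀ X : E, (∀ Y : E, B X Y = 0) → X = 0)
    (hS : IsEpsHypersymplectic B b ε S) :
    ∀ i : ZMod 3,
      (∀ X Y : E, B (transMor ε S i X) Y = (ε 0 * ε 1 * ε 2) * B X (transMor ε S i Y)) ∧
      transMor ε S i ∘ₗ transMor ε S i = ε i • (LinearMap.id : E →ₗ[ℝ] E) ∧
      transMor ε S (i - 1) ∘ₗ transMor ε S (i + 1) =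
        (ε 0 * ε 1 * ε 2) • (transMor ε S (i + 1) ∘ₗ transMor ε S (i - 1)) ∧
      transMor ε S (i - 1) ∘ₗ transMor ε S (i + 1) = ε i • transMor ε S i ∧
      transMor ε S 0 ∘ₗ transMor ε S 2 ∘ₗ transMor ε S 1 = (LinearMap.id : E →ₗ[ℝ] E) ∧
      (ε 0 * ε 1 * ε 2) • (transMor ε S 1 ∘ₗ transMor ε S 2 ∘ₗ transMor ε S 0) =
        (LinearMap.id : E →ₗ[ℝ] E) := by
  have hsq : ∀ i, ε i * ε i = 1 := fun i => by rcases hε i with h | h <;> simp [h]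
  have h₀ : (1 - 1 : ZMod 3) = 0 := by decide
  have h₂ : (1 + 1 : ZMod 3) = 2 := by decide
  have hcomp := hS.transMor_comp hsq 1
  have hswap := hS.transMor_comp_swap hsq 1
  rw [h₀, h₂] at hcomp hswap
  refine fun i => ⟨hS.bilin_transMor i, hS.transMor_comp_self hsq i,
    hS.transMor_comp_swap hsq i, hS.transMor_comp hsq i, ?_, ?_⟩
  · rw [← LinearMap.comp_assoc, hcomp, LinearMap.smul_comp, hS.transMor_comp_self hsq, smul_smul,
      hsq, one_smul]
  · rw [← LinearMap.comp_smul, ← hswap, hcomp, LinearMap.comp_smul, hS.transMor_comp_self hsq,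
      smul_smul, hsq, one_smul]
end

section
/- Let (S₁, S₂, S₃) be an ε-hypersymplectic structure on (E, B, b). Then the endomorphism G is well defined by any cyclic ordering, i.e. G = S₃ ∘ S₂ ∘ S₁ = S₁ ∘ S₃ ∘ S₂ = S₂ ∘ S₁ ∘ S₃, and it satisfies: (i) B(G X, Y) = −ε₁ε₂ε₃·B(X, G Y) for all X, Y ∈ E; (ii) G ∘ G = id_E. -/
variable {E : Type*} [AddCommGroup E] [Module ℝ E]

namespace IsEpsHypersymplectic

variable {B : E →ₗ[ℝ] E →ₗ[ℝ] ℝ} {b : E →ₗ[ℝ] E →ₗ[ℝ] E} {ε : ZMod 3 → ℝ}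
  {S : ZMod 3 → E →ₗ[ℝ] E}

theorem skew_apply (hS : IsEpsHypersymplectic B b ε S) (i : ZMod 3) (X Y : E) :
    B (S i X) Y = -B X (S i Y) :=
  hS.1 i X Y

theorem sq_apply (hS : IsEpsHypersymplectic B b ε S) (i : ZMod 3) (X : E) :
    S i (S i X) = ε i • X :=
  LinearMap.congr_fun (hS.2.1 i) X

theorem comm_apply (hS : IsEpsHypersymplectic B b ε S) {i j : ZMod 3} (hij : i ≠ j) (X : E) :
    S i (S j X) = (ε 0 * ε 1 * ε 2) • S j (S i X) :=
  LinearMap.congr_fun (hS.2.2.1 i j hij) X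

/-- Moving an endomorphism past two others produces the square of the sign `ε₁ε₂ε₃`. -/
theorem rotate_apply (hS : IsEpsHypersymplectic B b ε S)
    (hp : (ε 0 * ε 1 * ε 2) * (ε 0 * ε 1 * ε 2) = 1) {i j k : ZMod 3}
    (hij : i ≠ j) (hik : i ≠ k) (X : E) :
    S i (S j (S k X)) = S j (S k (S i X)) := by
  rw [hS.comm_apply hij, hS.comm_apply hik, map_smul, smul_smul, hp, one_smul]

end IsEpsHypersymplectic

theorem statement7 (B : E →ₗ[ℝ] E →ₗ[ℝ] ℝ) (b : E →ₗ[ℝ] E →ₗ[ℝ] E)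
    (ε : ZMod 3 → ℝ) (S : ZMod 3 → E →ₗ[ℝ] E)
    (hε : ∀ i, ε i = 1 ∨ ε i = -1)
    (hBsymm : ∀ X Y : E, B X Y = B Y X)
    (hBnd : ∀ X : E, (∀ Y : E, B X Y = 0) → X = 0)
    (hS : IsEpsHypersymplectic B b ε S) :
    metricG S = S 1 ∘ₗ S 0 ∘ₗ S 2 ∧
    metricG S = S 2 ∘ₗ S 1 ∘ₗ S 0 ∧
    (∀ X Y : E, B (metricG S X) Y = -(ε 0 * ε 1 * ε 2) * B X (metricG S Y)) ∧
    metricG S ∘ₗ metricG S = (LinearMap.id : E →ₗ[ℝ] E) := by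
  have hp : (ε 0 * ε 1 * ε 2) * (ε 0 * ε 1 * ε 2) = 1 := by
    rcases hε 0 with h0 | h0 <;> rcases hε 1 with h1 | h1 <;> rcases hε 2 with h2 | h2 <;>
      norm_num [h0, h1, h2]
  have h01 : (0 : ZMod 3) ≠ 1 := by decide
  have h02 : (0 : ZMod 3) ≠ 2 := by decide
  have h12 : (1 : ZMod 3) ≠ 2 := by decide
  refine ⟨LinearMap.ext fun X => hS.rotate_apply hp h01.symm h12 X |>.symm,
    LinearMap.ext fun X => hS.rotate_apply hp h02 h01 X, fun X Y => ?_,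
    LinearMap.ext fun X => ?_⟩
  · have reversed : S 1 (S 2 (S 0 Y)) = (ε 0 * ε 1 * ε 2) • S 0 (S 2 (S 1 Y)) := by
      rw [← hS.rotate_apply hp h01 h02, hS.comm_apply h12, map_smul]
    simp only [metricG, LinearMap.comp_apply, hS.skew_apply, neg_neg, reversed, map_smul,
      smul_eq_mul, neg_mul]
  · simp only [metricG, LinearMap.comp_apply, LinearMap.id_apply]
    rw [hS.rotate_apply hp h02 h01 (S 0 (S 2 (S 1 X))), hS.sq_apply]
    simp only [map_smul, hS.comm_apply h12, hS.sq_apply, smul_smul]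
    convert one_smul ℝ X using 2
    linear_combination hp
end

section
/- Let (S₁, S₂, S₃) be an ε-hypersymplectic structure on (E, B, b). Then for all i = 1, 2, 3 (indices modulo 3): (i) T_i ∘ S_i = S_i ∘ T_i = ε_{i−1}·G; (ii) G ∘ S_i = S_i ∘ G = ε_{i−1}ε_i·T_i; (iii) G ∘ T_i = T_i ∘ G = ε_{i−1}ε_i·S_i. Moreover, (iv) S_{i−1} ∘ T_i = ε₁ε₂ε₃·T_i ∘ S_{i−1} = S_{i+1} and S_{i+1} ∘ T_i = ε₁ε₂ε₃·T_i ∘ S_{i+1} = ε_i·S_{i−1}. -/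
variable {E : Type*} [AddCommGroup E] [Module ℝ E]

/-- The index-free form of the relations between the transition morphism `p • x ∘ z`, the
endomorphism `x ∘ z ∘ y` and the three endomorphisms `x`, `y`, `z`. -/
theorem transition_relations {M : Type*} [AddCommGroup M] [Module ℝ M]
    (x y z : M →ₗ[ℝ] M) (p q r : ℝ)
    (hp : p = 1 ∨ p = -1) (hq : q = 1 ∨ q = -1) (hr : r = 1 ∨ r = -1)
    (hx : x ∘ₗ x = p • LinearMap.id) (hy : y ∘ₗ y = q • LinearMap.id)
    (hz : z ∘ₗ z = r • LinearMap.id)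
    (hyx : y ∘ₗ x = (p * q * r) • (x ∘ₗ y)) (hzx : z ∘ₗ x = (p * q * r) • (x ∘ₗ z))
    (hzy : z ∘ₗ y = (p * q * r) • (y ∘ₗ z)) :
    (p • (x ∘ₗ z)) ∘ₗ y = p • (x ∘ₗ z ∘ₗ y) ∧
    y ∘ₗ (p • (x ∘ₗ z)) = p • (x ∘ₗ z ∘ₗ y) ∧
    (x ∘ₗ z ∘ₗ y) ∘ₗ y = (p * q) • (p • (x ∘ₗ z)) ∧
    y ∘ₗ (x ∘ₗ z ∘ₗ y) = (p * q) • (p • (x ∘ₗ z)) ∧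
    (x ∘ₗ z ∘ₗ y) ∘ₗ (p • (x ∘ₗ z)) = (p * q) • y ∧
    (p • (x ∘ₗ z)) ∘ₗ (x ∘ₗ z ∘ₗ y) = (p * q) • y ∧
    x ∘ₗ (p • (x ∘ₗ z)) = z ∧
    (p * q * r) • ((p • (x ∘ₗ z)) ∘ₗ x) = z ∧
    z ∘ₗ (p • (x ∘ₗ z)) = q • x ∧
    (p * q * r) • ((p • (x ∘ₗ z)) ∘ₗ z) = q • x := by
  replace hx v : x (x v) = p • v := LinearMap.congr_fun hx v
  replace hy v : y (y v) = q • v := LinearMap.congr_fun hy v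
  replace hz v : z (z v) = r • v := LinearMap.congr_fun hz v
  replace hyx v : y (x v) = (p * q * r) • x (y v) := LinearMap.congr_fun hyx v
  replace hzx v : z (x v) = (p * q * r) • x (z v) := LinearMap.congr_fun hzx v
  replace hzy v : z (y v) = (p * q * r) • y (z v) := LinearMap.congr_fun hzy v
  refine ⟨?_, ?_, ?_, ?_, ?_, ?_, ?_, ?_, ?_, ?_⟩ <;> ext v <;>
    simp only [LinearMap.comp_apply, LinearMap.smul_apply, map_smul, hx, hy, hz, hyx, hzx, hzy,
      smul_smul] <;>
    rcases hp with rfl | rfl <;> rcases hq with rfl | rfl <;> rcases hr with rfl | rfl <;>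
    norm_num

/-- An endomorphism that commutes with two others up to the same sign can be moved from the
left to the right of their product. -/
theorem comp_cyclic_of_commute_up_to_sign {M : Type*} [AddCommGroup M] [Module ℝ M]
    {x y z : M →ₗ[ℝ] M} {c : ℝ} (hc : c * c = 1)
    (hzx : z ∘ₗ x = c • (x ∘ₗ z)) (hzy : z ∘ₗ y = c • (y ∘ₗ z)) :
    z ∘ₗ x ∘ₗ y = x ∘ₗ y ∘ₗ z := by
  rw [← LinearMap.comp_assoc, hzx, LinearMap.smul_comp, LinearMap.comp_assoc, hzy,
    LinearMap.comp_smul, smul_smul, hc, one_smul]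

theorem statement8 (B : E →ₗ[ℝ] E →ₗ[ℝ] ℝ) (b : E →ₗ[ℝ] E →ₗ[ℝ] E)
    (ε : ZMod 3 → ℝ) (S : ZMod 3 → E →ₗ[ℝ] E)
    (hε : ∀ i, ε i = 1 ∨ ε i = -1)
    (hBsymm : ∀ X Y : E, B X Y = B Y X)
    (hBnd : ∀ X : E, (∀ Y : E, B X Y = 0) → X = 0)
    (hS : IsEpsHypersymplectic B b ε S) :
    ∀ i : ZMod 3,
      transMor ε S i ∘ₗ S i = ε (i - 1) • metricG S ∧
      S i ∘ₗ transMor ε S i = ε (i - 1) • metricG S ∧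
      metricG S ∘ₗ S i = (ε (i - 1) * ε i) • transMor ε S i ∧
      S i ∘ₗ metricG S = (ε (i - 1) * ε i) • transMor ε S i ∧
      metricG S ∘ₗ transMor ε S i = (ε (i - 1) * ε i) • S i ∧
      transMor ε S i ∘ₗ metricG S = (ε (i - 1) * ε i) • S i ∧
      S (i - 1) ∘ₗ transMor ε S i = S (i + 1) ∧
      (ε 0 * ε 1 * ε 2) • (transMor ε S i ∘ₗ S (i - 1)) = S (i + 1) ∧
      S (i + 1) ∘ₗ transMor ε S i = ε i • S (i - 1) ∧
      (ε 0 * ε 1 * ε 2) • (transMor ε S i ∘ₗ S (i + 1)) = ε i • S (i - 1) := by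
  obtain ⟨-, hsq, hcomm, -⟩ := hS
  have hsign : (ε 0 * ε 1 * ε 2) * (ε 0 * ε 1 * ε 2) = 1 := by
    rcases hε 0 with h0 | h0 <;> rcases hε 1 with h1 | h1 <;> rcases hε 2 with h2 | h2 <;>
      norm_num [h0, h1, h2]
  intro i
  have hprod : ε 0 * ε 1 * ε 2 = ε (i - 1) * ε i * ε (i + 1) := by
    fin_cases i
    · change _ = ε 2 * ε 0 * ε 1
      ring
    · rfl
    · change _ = ε 1 * ε 2 * ε 0
      ring
  have hG : metricG S = S (i - 1) ∘ₗ S (i + 1) ∘ₗ S i := by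
    fin_cases i
    · exact comp_cyclic_of_commute_up_to_sign hsign
        (hcomm 0 2 (by decide)) (hcomm 0 1 (by decide))
    · rfl
    · exact (comp_cyclic_of_commute_up_to_sign hsign
        (hcomm 1 0 (by decide)) (hcomm 1 2 (by decide))).symm
  rw [hprod] at hcomm ⊢
  rw [hG]
  have hne : ∀ j : ZMod 3, j ≠ j - 1 ∧ j + 1 ≠ j - 1 ∧ j + 1 ≠ j := by decide
  exact transition_relations _ _ _ _ _ _ (hε _) (hε _) (hε _) (hsq _) (hsq _) (hsq _)
    (hcomm _ _ (hne i).1) (hcomm _ _ (hne i).2.1) (hcomm _ _ (hne i).2.2)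
end

section
/- Let (S₁, S₂, S₃) be an ε-hypersymplectic structure on (E, B, b). Then for all i = 1, 2, 3 (indices modulo 3) and all X, Y ∈ E: B(G(T_i X), T_i Y) = ε_{i−1}ε_{i+1}·B(G X, Y). -/
variable {E : Type*} [AddCommGroup E] [Module ℝ E]

namespace IsEpsHypersymplectic

variable {B : E →ₗ[ℝ] E →ₗ[ℝ] ℝ} {b : E →ₗ[ℝ] E →ₗ[ℝ] E}
  {ε : ZMod 3 → ℝ} {S : ZMod 3 → E →ₗ[ℝ] E}

/-- `G` commutes with every `S j`: two of its three factors commute with `S j` up to the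
sign `ε₁ε₂ε₃`, and the third one is `S j`. -/
theorem metricG_apply_comm (hS : IsEpsHypersymplectic B b ε S)
    (hε : ∀ i, ε i = 1 ∨ ε i = -1) (j : ZMod 3) (X : E) :
    metricG S (S j X) = S j (metricG S X) := by
  obtain ⟨-, -, hcomm, -⟩ := hS
  have hsq : (ε 0 * ε 1 * ε 2) * (ε 0 * ε 1 * ε 2) = 1 := by
    rcases hε 0 with h0 | h0 <;> rcases hε 1 with h1 | h1 <;> rcases hε 2 with h2 | h2 <;>
      norm_num [h0, h1, h2]
  have hswap : ∀ i k, i ≠ k → ∀ Z, S i (S k Z) = (ε 0 * ε 1 * ε 2) • S k (S i Z) :=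
    fun i k hik Z => LinearMap.congr_fun (hcomm i k hik) Z
  have hj : j = 0 ∨ j = 1 ∨ j = 2 := by revert j; decide
  simp only [metricG, LinearMap.comp_apply]
  rcases hj with rfl | rfl | rfl
  · rw [hswap 1 0 (by decide), map_smul, hswap 2 0 (by decide), smul_smul, hsq, one_smul]
  · rw [hswap 1 0 (by decide), hswap 1 2 (by decide), map_smul, smul_smul, hsq, one_smul]
  · rw [hswap 1 2 (by decide), hswap 2 0 (by decide), map_smul, map_smul]

/-- Each `S i` is a similitude of `B` with factor `-ε i`. -/
theorem apply_apply (hS : IsEpsHypersymplectic B b ε S) (i : ZMod 3) (X Y : E) :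
    B (S i X) (S i Y) = -ε i * B X Y := by
  have h : S i (S i Y) = ε i • Y := LinearMap.congr_fun (hS.2.1 i) Y
  rw [hS.1, h, map_smul, smul_eq_mul, neg_mul]

end IsEpsHypersymplectic

theorem statement9 (B : E →ₗ[ℝ] E →ₗ[ℝ] ℝ) (b : E →ₗ[ℝ] E →ₗ[ℝ] E)
    (ε : ZMod 3 → ℝ) (S : ZMod 3 → E →ₗ[ℝ] E)
    (hε : ∀ i, ε i = 1 ∨ ε i = -1)
    (hBsymm : ∀ X Y : E, B X Y = B Y X)
    (hBnd : ∀ X : E, (∀ Y : E, B X Y = 0) → X = 0)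
    (hS : IsEpsHypersymplectic B b ε S) :
    ∀ i : ZMod 3, ∀ X Y : E,
      B (metricG S (transMor ε S i X)) (transMor ε S i Y) =
        (ε (i - 1) * ε (i + 1)) * B (metricG S X) Y := by
  intro i X Y
  have hsq : ε (i - 1) * ε (i - 1) = 1 := by
    rcases hε (i - 1) with h | h <;> norm_num [h]
  simp only [transMor, LinearMap.smul_apply, LinearMap.comp_apply, map_smul, smul_eq_mul,
    hS.metricG_apply_comm hε, hS.apply_apply]
  linear_combination (ε (i - 1) * ε (i + 1) * B (metricG S X) Y) * hsq
end

section
/- Suppose ε₁ε₂ε₃ = −1 and let (S₁, S₂, S₃) be an ε-hypersymplectic structure on (E, B, b). Then each transition endomorphism T_i is a Nijenhuis morphism: T_b T_i = 0 for i = 1, 2, 3. Moreover T_i ∘ T_i = ε_i·id_E, so that T_i is a complex structure (T_i² = −id_E with vanishing Nijenhuis torsion) if ε_i = −1, and a para-complex structure (T_i² = id_E with vanishing Nijenhuis torsion) if ε_i = 1. -/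
variable {E : Type*} [AddCommGroup E] [Module ℝ E]

lemma torsion_apply (b : E →ₗ[ℝ] E →ₗ[ℝ] E) (I : E →ₗ[ℝ] E) (X Y : E) :
    torsion b I X Y = b (I X) (I Y) - I (b (I X) Y) - I (b X (I Y)) + I (I (b X Y)) := by
  simp only [torsion, deform, LinearMap.sub_apply, LinearMap.add_apply, LinearMap.comp_apply,
    LinearMap.compl₂_apply, LinearMap.compr₂_apply, map_add, map_sub]
  abel

lemma torsion_smul (b : E →ₗ[ℝ] E →ₗ[ℝ] E) (c : ℝ) (I : E →ₗ[ℝ] E) (X Y : E) :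
    torsion b (c • I) X Y = (c * c) • torsion b I X Y := by
  simp only [torsion_apply, LinearMap.smul_apply, map_smul]
  module

/-- If `I² = e • id`, then `b_{I,I} = e • b + 2 T_b I`. -/
lemma deform_deform_apply (b : E →ₗ[ℝ] E →ₗ[ℝ] E) {I : E →ₗ[ℝ] E} {e : ℝ}
    (hI : ∀ X, I (I X) = e • X) (X Y : E) :
    deform (deform b I) I X Y = e • b X Y + (2 : ℝ) • torsion b I X Y := by
  rw [torsion_apply]
  simp only [deform, LinearMap.sub_apply, LinearMap.add_apply, LinearMap.comp_apply,
    LinearMap.compl₂_apply, LinearMap.compr₂_apply, map_add, map_sub, hI, map_smul,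
    LinearMap.smul_apply]
  module

lemma torsion_eq_zero_of_deform_deform (b : E →ₗ[ℝ] E →ₗ[ℝ] E) {I : E →ₗ[ℝ] E} {e : ℝ}
    (hI : ∀ X, I (I X) = e • X) (hb : deform (deform b I) I = e • b) (X Y : E) :
    torsion b I X Y = 0 := by
  have h := deform_deform_apply b hI X Y
  rw [hb, LinearMap.smul_apply, LinearMap.smul_apply, left_eq_add] at h
  exact (smul_eq_zero.mp h).resolve_left two_ne_zero

/-- The torsion of a product of anticommuting endomorphisms with scalar squares, in terms of the
torsions of the factors. -/
lemma two_smul_torsion_comp (b : E →ₗ[ℝ] E →ₗ[ℝ] E) {I J : E →ₗ[ℝ] E} {e f : ℝ}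
    (hI : ∀ X, I (I X) = e • X) (hJ : ∀ X, J (J X) = f • X)
    (hJI : ∀ X, J (I X) = -I (J X)) (X Y : E) :
    (2 : ℝ) • torsion b (I ∘ₗ J) X Y =
      torsion b I (J X) (J Y) - J (torsion b I (J X) Y) - J (torsion b I X (J Y))
        - f • torsion b I X Y
      + (torsion b J (I X) (I Y) - I (torsion b J (I X) Y) - I (torsion b J X (I Y))
        - e • torsion b J X Y) := by
  simp only [torsion_apply, LinearMap.comp_apply, map_add, map_sub, map_neg, map_smul,
    LinearMap.neg_apply, hI, hJ, hJI]
  module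

lemma torsion_comp_eq_zero (b : E →ₗ[ℝ] E →ₗ[ℝ] E) {I J : E →ₗ[ℝ] E} {e f : ℝ}
    (hI : ∀ X, I (I X) = e • X) (hJ : ∀ X, J (J X) = f • X)
    (hJI : ∀ X, J (I X) = -I (J X))
    (hTI : ∀ X Y, torsion b I X Y = 0) (hTJ : ∀ X Y, torsion b J X Y = 0) (X Y : E) :
    torsion b (I ∘ₗ J) X Y = 0 := by
  have h := two_smul_torsion_comp b hI hJ hJI X Y
  simp only [hTI, hTJ, map_zero, smul_zero, sub_zero, add_zero] at h
  exact (smul_eq_zero.mp h).resolve_left two_ne_zero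

theorem statement10 (B : E →ₗ[ℝ] E →ₗ[ℝ] ℝ) (b : E →ₗ[ℝ] E →ₗ[ℝ] E)
    (ε : ZMod 3 → ℝ) (S : ZMod 3 → E →ₗ[ℝ] E)
    (hε : ∀ i, ε i = 1 ∨ ε i = -1)
    (hBsymm : ∀ X Y : E, B X Y = B Y X)
    (hBnd : ∀ X : E, (∀ Y : E, B X Y = 0) → X = 0)
    (he : ε 0 * ε 1 * ε 2 = -1)
    (hS : IsEpsHypersymplectic B b ε S) :
    ∀ i : ZMod 3,
      (∀ X Y : E, torsion b (transMor ε S i) X Y = 0) ∧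
      transMor ε S i ∘ₗ transMor ε S i = ε i • (LinearMap.id : E →ₗ[ℝ] E) ∧
      (ε i = -1 →
        transMor ε S i ∘ₗ transMor ε S i = -(LinearMap.id : E →ₗ[ℝ] E) ∧
        ∀ X Y : E, torsion b (transMor ε S i) X Y = 0) ∧
      (ε i = 1 →
        transMor ε S i ∘ₗ transMor ε S i = (LinearMap.id : E →ₗ[ℝ] E) ∧
        ∀ X Y : E, torsion b (transMor ε S i) X Y = 0) := by
  obtain ⟨-, hsq, hanti, hdef⟩ := hS
  have hsq' : ∀ i X, S i (S i X) = ε i • X := fun i X => LinearMap.congr_fun (hsq i) X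
  have hanti' : ∀ i j, i ≠ j → ∀ X, S i (S j X) = -S j (S i X) := fun i j hij X => by
    simpa [he] using LinearMap.congr_fun (hanti i j hij) X
  have htor : ∀ i X Y, torsion b (S i) X Y = 0 := fun i =>
    torsion_eq_zero_of_deform_deform b (hsq' i) (hdef i)
  have hεsq : ∀ i, ε i * ε i = 1 := fun i => by rcases hε i with h | h <;> simp [h]
  intro i
  have hne : i + 1 ≠ i - 1 := by revert i; decide
  have hprod : ε (i - 1) * ε i * ε (i + 1) = -1 := by
    rw [← he]
    fin_cases i
    · change ε 2 * ε 0 * ε 1 = _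
      ring
    · rfl
    · change ε 1 * ε 2 * ε 0 = _
      ring
  have hT : ∀ X Y : E, torsion b (transMor ε S i) X Y = 0 := fun X Y => by
    rw [transMor, torsion_smul, torsion_comp_eq_zero b (hsq' _) (hsq' _) (hanti' _ _ hne)
      (htor _) (htor _), smul_zero]
  have hTT : transMor ε S i ∘ₗ transMor ε S i = ε i • (LinearMap.id : E →ₗ[ℝ] E) := by
    ext X
    simp only [transMor, LinearMap.comp_apply, LinearMap.smul_apply, map_smul,
      hanti' _ _ hne, hsq', LinearMap.id_apply, smul_smul, ← neg_smul]
    congr 1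
    linear_combination ε (i - 1) * ε (i + 1) * (hεsq i - hεsq (i - 1)) - ε i * hprod
  refine ⟨hT, hTT, fun h => ⟨?_, hT⟩, fun h => ⟨?_, hT⟩⟩
  · rw [hTT, h, neg_one_smul]
  · rw [hTT, h, one_smul]
end

section
/- Suppose ε₁ε₂ε₃ = −1, and let (S₁, S₂, S₃) be a triple of skew-symmetric ℝ-linear endomorphisms of E satisfying S_k ∘ S_k = ε_k·id_E for k = 1, 2, 3 and S_k ∘ S_l = ε₁ε₂ε₃·S_l ∘ S_k for k ≠ l, with transition endomorphisms T_j := ε_{j−1}·S_{j−1} ∘ S_{j+1}. Then for any fixed i, j ∈ {1, 2, 3} the following are equivalent: (a) (S₁, S₂, S₃) is an ε-hypersymplectic structure on (E, B, b); (b) (S₁, S₂, S₃) is an ε-hypersymplectic structure on (E, B, b_{S_i}), where b_{S_i} is the deformation of b by S_i; (c) (S₁, S₂, S₃) is an ε-hypersymplectic structure on (E, B, b_{T_j}), where b_{T_j} is the deformation of b by T_j. -/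
variable {E : Type*} [AddCommGroup E] [Module ℝ E]

/-- Deformation by a fixed endomorphism, as a linear map on brackets. -/
noncomputable def deformLinear (I : E →ₗ[ℝ] E) :
    (E →ₗ[ℝ] E →ₗ[ℝ] E) →ₗ[ℝ] (E →ₗ[ℝ] E →ₗ[ℝ] E) where
  toFun b := deform b I
  map_add' b c := by
    ext X Y
    simp only [deform_apply, LinearMap.add_apply, map_add]
    abel
  map_smul' r b := by
    ext X Y
    simp only [deform_apply, LinearMap.smul_apply, map_smul, RingHom.id_apply]
    module

theorem deformLinear_apply (I : E →ₗ[ℝ] E) (b : E →ₗ[ℝ] E →ₗ[ℝ] E) :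
    deformLinear I b = deform b I := rfl

/-- Deformation represents the commutator of endomorphisms. -/
theorem deform_deform_sub_deform_deform (b : E →ₗ[ℝ] E →ₗ[ℝ] E) (I J : E →ₗ[ℝ] E) :
    deform (deform b I) J - deform (deform b J) I = deform b (I ∘ₗ J - J ∘ₗ I) := by
  ext X Y
  simp only [deform_apply, LinearMap.sub_apply, LinearMap.comp_apply, map_add, map_sub]
  abel

theorem deform_smul (b : E →ₗ[ℝ] E →ₗ[ℝ] E) (r : ℝ) (I : E →ₗ[ℝ] E) :
    deform b (r • I) = r • deform b I := by
  ext X Y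
  simp only [deform_apply, LinearMap.smul_apply, map_smul]
  module

theorem deform_comp_of_anticomm (b : E →ₗ[ℝ] E →ₗ[ℝ] E) {I J : E →ₗ[ℝ] E}
    (h : I ∘ₗ J = -(J ∘ₗ I)) :
    deform b (I ∘ₗ J) =
      (1 / 2 : ℝ) • (deform (deform b I) J - deform (deform b J) I) := by
  have hsub : I ∘ₗ J - J ∘ₗ I = (2 : ℝ) • (I ∘ₗ J) := by
    rw [← neg_eq_iff_eq_neg.mpr h]
    module
  rw [deform_deform_sub_deform_deform, hsub, deform_smul, smul_smul]
  norm_num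

theorem deform_deform_self_eq_iff (b : E →ₗ[ℝ] E →ₗ[ℝ] E) {I : E →ₗ[ℝ] E} {c : ℝ}
    (hI : ∀ X, I (I X) = c • X) :
    deform (deform b I) I = c • b ↔ ∀ X Y, torsion b I X Y = 0 := by
  have key (X Y : E) :
      deform (deform b I) I X Y - c • b X Y = (2 : ℝ) • torsion b I X Y := by
    simp only [torsion, deform_apply, map_add, map_sub, hI, map_smul, LinearMap.smul_apply]
    module
  constructor
  · intro h X Y
    have := key X Y
    rw [h, LinearMap.smul_apply, LinearMap.smul_apply, sub_self] at this
    exact (smul_eq_zero.mp this.symm).resolve_left two_ne_zero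
  · intro h
    ext X Y
    simpa only [h, smul_zero, sub_eq_zero, LinearMap.smul_apply] using key X Y

/-- The eigenvalues of deformation by a square root of `c` are `±√c` and `±3√c`. -/
theorem deform_quartic (b : E →ₗ[ℝ] E →ₗ[ℝ] E) {I : E →ₗ[ℝ] E} {c : ℝ}
    (hI : ∀ X, I (I X) = c • X) :
    deform (deform (deform (deform b I) I) I) I =
      (10 * c) • deform (deform b I) I - (9 * c ^ 2) • b := by
  ext X Y
  simp only [deform_apply, map_add, map_sub, hI, map_smul, LinearMap.smul_apply,
    LinearMap.sub_apply]
  module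

theorem torsion_deform_eq_zero (b : E →ₗ[ℝ] E →ₗ[ℝ] E) {I J : E →ₗ[ℝ] E} {c d : ℝ}
    (hc : c = 1 ∨ c = -1) (hd : d = 1 ∨ d = -1)
    (hI : ∀ X, I (I X) = c • X) (hJ : ∀ X, J (J X) = d • X)
    (hJI : ∀ X, J (I X) = -I (J X))
    (tI : ∀ X Y, torsion b I X Y = 0) (tJ : ∀ X Y, torsion b J X Y = 0) (X Y : E) :
    torsion (deform b I) J X Y = 0 := by
  have h₁ := tI (I (J X)) (J Y)
  have h₂ := congrArg I (tI (I X) (I Y))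
  have h₃ := congrArg J (tI (I (J X)) Y)
  have h₄ := congrArg (fun Z => I (J Z)) (tI (I X) (I (J Y)))
  have h₅ := congrArg (fun Z => I (J Z)) (tJ (I X) (I (J Y)))
  simp only [torsion, deform_apply, map_add, map_sub, map_neg, map_zero, hI, hJ, hJI, map_smul,
    LinearMap.smul_apply, LinearMap.neg_apply] at h₁ h₂ h₃ h₄ h₅ ⊢
  rcases hc with rfl | rfl <;> rcases hd with rfl | rfl
  · linear_combination (norm := module) h₁ - h₂ - h₃ - h₄ + h₅
  · linear_combination (norm := module) h₁ + h₂ - h₃ - h₄ - h₅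
  · linear_combination (norm := module) -h₁ - h₂ + h₃ - h₄ - h₅
  · linear_combination (norm := module) -h₁ + h₂ + h₃ - h₄ + h₅

/-- The brackets whose second deformation by each `S i` is multiplication by `ε i`. -/
noncomputable def compatibleBrackets (ε : ZMod 3 → ℝ) (S : ZMod 3 → E →ₗ[ℝ] E) :
    Submodule ℝ (E →ₗ[ℝ] E →ₗ[ℝ] E) :=
  ⨅ i, LinearMap.ker (deformLinear (S i) ∘ₗ deformLinear (S i) - ε i • LinearMap.id)

theorem mem_compatibleBrackets {ε : ZMod 3 → ℝ} {S : ZMod 3 → E →ₗ[ℝ] E}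
    {b : E →ₗ[ℝ] E →ₗ[ℝ] E} :
    b ∈ compatibleBrackets ε S ↔ ∀ i, deform (deform b (S i)) (S i) = ε i • b := by
  simp only [compatibleBrackets, Submodule.mem_iInf, LinearMap.mem_ker, LinearMap.sub_apply,
    LinearMap.comp_apply, LinearMap.smul_apply, LinearMap.id_apply, deformLinear_apply,
    sub_eq_zero]

theorem deform_mem_compatibleBrackets {ε : ZMod 3 → ℝ} {S : ZMod 3 → E →ₗ[ℝ] E}
    (hε : ∀ i, ε i = 1 ∨ ε i = -1) (hsq : ∀ k X, S k (S k X) = ε k • X)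
    (hanti : ∀ k l, k ≠ l → S k ∘ₗ S l = -(S l ∘ₗ S k)) (i : ZMod 3)
    {b : E →ₗ[ℝ] E →ₗ[ℝ] E} (hb : b ∈ compatibleBrackets ε S) :
    deform b (S i) ∈ compatibleBrackets ε S := by
  rw [mem_compatibleBrackets] at hb ⊢
  intro j
  by_cases hij : j = i
  · subst hij
    rw [hb, ← deformLinear_apply, map_smul, deformLinear_apply]
  · exact (deform_deform_self_eq_iff _ (hsq j)).mpr
      (torsion_deform_eq_zero b (hε i) (hε j) (hsq i) (hsq j)
        (fun X => LinearMap.congr_fun (hanti j i hij) X)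
        ((deform_deform_self_eq_iff b (hsq i)).mp (hb i))
        ((deform_deform_self_eq_iff b (hsq j)).mp (hb j)))

/-- A submodule stable under deformation by `I`, where `I² = c ≠ 0`, also reflects membership,
since deformation by `I` is then invertible with inverse a polynomial in itself. -/
theorem deform_mem_iff {V : Submodule ℝ (E →ₗ[ℝ] E →ₗ[ℝ] E)} {I : E →ₗ[ℝ] E} {c : ℝ}
    (hc : c ≠ 0) (hI : ∀ X, I (I X) = c • X) (hV : ∀ b ∈ V, deform b I ∈ V)
    (b : E →ₗ[ℝ] E →ₗ[ℝ] E) : b ∈ V ↔ deform b I ∈ V := by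
  refine ⟨hV b, fun h => ?_⟩
  have h₂ := hV _ h
  have h₄ := hV _ (hV _ h₂)
  rw [deform_quartic b hI] at h₄
  have h₉ : (9 * c ^ 2) • b ∈ V := by
    simpa only [sub_sub_cancel] using V.sub_mem (V.smul_mem (10 * c) h₂) h₄
  exact (V.smul_mem_iff (by positivity)).mp h₉

theorem statement12 (B : E →ₗ[ℝ] E →ₗ[ℝ] ℝ) (b : E →ₗ[ℝ] E →ₗ[ℝ] E)
    (ε : ZMod 3 → ℝ) (S : ZMod 3 → E →ₗ[ℝ] E)
    (hε : ∀ i, ε i = 1 ∨ ε i = -1)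
    (hBsymm : ∀ X Y : E, B X Y = B Y X)
    (hBnd : ∀ X : E, (∀ Y : E, B X Y = 0) → X = 0)
    (he : ε 0 * ε 1 * ε 2 = -1)
    (hskew : ∀ k, ∀ X Y : E, B (S k X) Y = - B X (S k Y))
    (hsq : ∀ k, S k ∘ₗ S k = ε k • (LinearMap.id : E →ₗ[ℝ] E))
    (hanti : ∀ k l, k ≠ l → S k ∘ₗ S l = (ε 0 * ε 1 * ε 2) • (S l ∘ₗ S k))
    (i j : ZMod 3) :
    (IsEpsHypersymplectic B b ε S ↔ IsEpsHypersymplectic B (deform b (S i)) ε S) ∧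
    (IsEpsHypersymplectic B b ε S ↔
      IsEpsHypersymplectic B (deform b (transMor ε S j)) ε S) := by
  have hsq' : ∀ k X, S k (S k X) = ε k • X := fun k X => LinearMap.congr_fun (hsq k) X
  have hanti' : ∀ k l, k ≠ l → S k ∘ₗ S l = -(S l ∘ₗ S k) := fun k l hkl => by
    rw [hanti k l hkl, he, neg_one_smul]
  have hne : ∀ k, ε k ≠ 0 := fun k => by rcases hε k with h | h <;> simp [h]
  have iff_mem : ∀ c : E →ₗ[ℝ] E →ₗ[ℝ] E,
      IsEpsHypersymplectic B c ε S ↔ c ∈ compatibleBrackets ε S := fun c =>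
    ⟨fun h => mem_compatibleBrackets.mpr h.2.2.2,
      fun h => ⟨hskew, hsq, hanti, mem_compatibleBrackets.mp h⟩⟩
  have stable := fun k c (hc : c ∈ compatibleBrackets ε S) =>
    deform_mem_compatibleBrackets hε hsq' hanti' k hc
  have hj : j - 1 ≠ j + 1 := by revert j; decide
  simp only [iff_mem]
  refine ⟨deform_mem_iff (hne i) (hsq' i) (stable i) b,
    deform_mem_iff (c := -(ε (j - 1) ^ 3 * ε (j + 1)))
      (neg_ne_zero.mpr (mul_ne_zero (pow_ne_zero 3 (hne _)) (hne _))) (fun X => ?_)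
      (fun c hc => ?_) b⟩
  · have hswap := fun Z => LinearMap.congr_fun (hanti' _ _ hj.symm) Z
    simp only [LinearMap.comp_apply, LinearMap.neg_apply] at hswap
    simp only [transMor, LinearMap.smul_apply, LinearMap.comp_apply, map_smul, hswap, map_neg,
      hsq']
    module
  · rw [transMor, deform_smul, deform_comp_of_anticomm c (hanti' _ _ hj)]
    exact Submodule.smul_mem _ _ (Submodule.smul_mem _ _ (Submodule.sub_mem _
      (stable _ _ (stable _ _ hc)) (stable _ _ (stable _ _ hc))))
end

section
/- With the notation of the context: (i) for each i = 1, 2, 3, S_i ∘ S_i = ε_i·id_{A⊕A*} if and only if π_i ∘ ω_i = id_A; (ii) if π_k ∘ ω_k = id_A for k = 1, 2, 3, then for each i = 1, 2, 3, S_{i−1} ∘ S_{i+1} = ε₁ε₂ε₃·S_{i+1} ∘ S_{i−1} if and only if N_i ∘ N_i = ε_i·id_A. -/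
variable {A : Type*} [AddCommGroup A] [Module ℝ A]

/-- The endomorphism `Sᵢ` of `A ⊕ A*` given by `Sᵢ(X, α) = (εᵢ • πᵢ α, ωᵢ X)`,
where the 2-form `ωᵢ` is viewed as a map `A → A*` and the bivector `πᵢ` as a map
`A* → A`. -/
noncomputable def Smor (ε : ZMod 3 → ℝ)
    (ω : ZMod 3 → A →ₗ[ℝ] Module.Dual ℝ A)
    (π : ZMod 3 → Module.Dual ℝ A →ₗ[ℝ] A) (i : ZMod 3) :
    (A × Module.Dual ℝ A) →ₗ[ℝ] A × Module.Dual ℝ A :=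
  LinearMap.prod ((ε i • π i) ∘ₗ LinearMap.snd ℝ A (Module.Dual ℝ A))
    (ω i ∘ₗ LinearMap.fst ℝ A (Module.Dual ℝ A))

/-- The transition endomorphism `Nᵢ := π_{i-1} ∘ ω_{i+1} : A → A`. -/
noncomputable def Nmor (ω : ZMod 3 → A →ₗ[ℝ] Module.Dual ℝ A)
    (π : ZMod 3 → Module.Dual ℝ A →ₗ[ℝ] A) (i : ZMod 3) : A →ₗ[ℝ] A :=
  π (i - 1) ∘ₗ ω (i + 1)

/-- A one-sided inverse of a skew-symmetric map by a skew-symmetric map is two-sided. -/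
theorem comp_eq_id_of_skew {ω : A →ₗ[ℝ] Module.Dual ℝ A} {π : Module.Dual ℝ A →ₗ[ℝ] A}
    (hω : ∀ X Y : A, ω X Y = -(ω Y X))
    (hπ : ∀ α β : Module.Dual ℝ A, β (π α) = -(α (π β)))
    (h : ∀ X, π (ω X) = X) (α : Module.Dual ℝ A) : ω (π α) = α := by
  ext X
  rw [hω, hπ, neg_neg, h]

theorem Smor_apply (ε : ZMod 3 → ℝ) (ω : ZMod 3 → A →ₗ[ℝ] Module.Dual ℝ A)
    (π : ZMod 3 → Module.Dual ℝ A →ₗ[ℝ] A) (i : ZMod 3) (x : A × Module.Dual ℝ A) :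
    Smor ε ω π i x = (ε i • π i x.2, ω i x.1) := rfl

theorem Nmor_apply (ω : ZMod 3 → A →ₗ[ℝ] Module.Dual ℝ A)
    (π : ZMod 3 → Module.Dual ℝ A →ₗ[ℝ] A) (i : ZMod 3) (X : A) :
    Nmor ω π i X = π (i - 1) (ω (i + 1) X) := rfl

theorem prod_univ_zmod_three (ε : ZMod 3 → ℝ) (i : ZMod 3) :
    ε 0 * ε 1 * ε 2 = ε i * ε (i - 1) * ε (i + 1) := by
  have key : ∀ j : ZMod 3, (j = 0 ∧ j - 1 = 2 ∧ j + 1 = 1) ∨ (j = 1 ∧ j - 1 = 0 ∧ j + 1 = 2) ∨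
      (j = 2 ∧ j - 1 = 1 ∧ j + 1 = 0) := by decide
  rcases key i with ⟨h, h', h''⟩ | ⟨h, h', h''⟩ | ⟨h, h', h''⟩ <;> rw [h', h'', h] <;> ring

theorem statement17 [FiniteDimensional ℝ A]
    (ε : ZMod 3 → ℝ) (hε : ∀ i, ε i = 1 ∨ ε i = -1)
    (ω : ZMod 3 → A →ₗ[ℝ] Module.Dual ℝ A)
    (π : ZMod 3 → Module.Dual ℝ A →ₗ[ℝ] A)
    (hω : ∀ i, ∀ X Y : A, ω i X Y = -(ω i Y X))
    (hπ : ∀ i, ∀ α β : Module.Dual ℝ A, β (π i α) = -(α (π i β))) :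
    (∀ i, Smor ε ω π i ∘ₗ Smor ε ω π i =
        ε i • (LinearMap.id : (A × Module.Dual ℝ A) →ₗ[ℝ] A × Module.Dual ℝ A) ↔
      π i ∘ₗ ω i = (LinearMap.id : A →ₗ[ℝ] A)) ∧
    ((∀ k, π k ∘ₗ ω k = (LinearMap.id : A →ₗ[ℝ] A)) →
      ∀ i, Smor ε ω π (i - 1) ∘ₗ Smor ε ω π (i + 1) =
          (ε 0 * ε 1 * ε 2) • (Smor ε ω π (i + 1) ∘ₗ Smor ε ω π (i - 1)) ↔
        Nmor ω π i ∘ₗ Nmor ω π i = ε i • (LinearMap.id : A →ₗ[ℝ] A)) := by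
  have sq : ∀ i, ε i * ε i = 1 := fun i ↦ by rcases hε i with h | h <;> rw [h] <;> norm_num
  refine ⟨fun i ↦ ⟨fun h ↦ ?_, fun h ↦ ?_⟩, fun h i ↦ ?_⟩
  · ext X
    have h1 := congrArg Prod.fst (LinearMap.congr_fun h (X, 0))
    simp only [LinearMap.comp_apply, Smor_apply, LinearMap.smul_apply, LinearMap.id_apply,
      Prod.smul_mk] at h1
    have h2 := congrArg (ε i • ·) h1
    simpa only [smul_smul, sq, one_smul, LinearMap.comp_apply, LinearMap.id_apply] using h2
  · have hl : ∀ X, π i (ω i X) = X := LinearMap.congr_fun h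
    refine LinearMap.ext fun x ↦ Prod.ext ?_ ?_
    · simp [Smor_apply, hl]
    · simp [Smor_apply, comp_eq_id_of_skew (hω i) (hπ i) hl]
  have hl : ∀ k X, π k (ω k X) = X := fun k ↦ LinearMap.congr_fun (h k)
  have hr : ∀ k α, ω k (π k α) = α := fun k ↦ comp_eq_id_of_skew (hω k) (hπ k) (hl k)
  rw [prod_univ_zmod_three ε i]
  have ha := sq (i - 1)
  have hb := sq (i + 1)
  have hi := sq i
  constructor
  · intro hS
    ext X
    have h1 := congrArg Prod.fst (LinearMap.congr_fun hS (X, 0))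
    simp only [LinearMap.comp_apply, Smor_apply, LinearMap.smul_apply, Prod.smul_mk] at h1
    have h2 := congrArg (ε (i - 1) • ·) h1
    simp only [smul_smul, ha, one_smul] at h2
    have e : ε (i - 1) * (ε i * ε (i - 1) * ε (i + 1) * ε (i + 1)) = ε i := by
      linear_combination ε i * ε (i + 1) * ε (i + 1) * ha + ε i * hb
    simp only [LinearMap.comp_apply, Nmor_apply, LinearMap.smul_apply, LinearMap.id_apply]
    rw [h2, e]
    simp only [map_smul, hr, hl]
  · intro hN
    have key : ∀ X, π (i - 1) (ω (i + 1) X) = ε i • π (i + 1) (ω (i - 1) X) := fun X ↦ by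
      have h1 := congrArg (fun Y ↦ π (i + 1) (ω (i - 1) Y)) (LinearMap.congr_fun hN X)
      simpa only [LinearMap.comp_apply, Nmor_apply, LinearMap.smul_apply, LinearMap.id_apply,
        map_smul, hr, hl] using h1
    refine LinearMap.ext fun x ↦ Prod.ext ?_ ?_
    · simp only [LinearMap.comp_apply, Smor_apply, LinearMap.smul_apply, Prod.smul_mk, key,
        smul_smul]
      congr 1
      linear_combination -ε i * ε (i - 1) * hb
    · have h2 : ω (i + 1) (π (i - 1) x.2) = ε i • ω (i - 1) (π (i + 1) x.2) := by
        have h3 := congrArg (ω (i + 1)) (key (π (i + 1) x.2))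
        simpa only [map_smul, hr] using h3
      simp only [LinearMap.comp_apply, Smor_apply, LinearMap.smul_apply, Prod.smul_mk, map_smul,
        h2, smul_smul]
      congr 1
      linear_combination -ε (i + 1) * ε (i - 1) * ε (i - 1) * hi - ε (i + 1) * ha
end

section
/- Let I be any ℝ-linear endomorphism of E. Then for all X, Y ∈ E: T_{b_I} I(X,Y) = T_b I(I X, Y) + T_b I(X, I Y) − I(T_b I(X,Y)), where T_{b_I} denotes the Nijenhuis torsion taken with respect to the deformed bracket b_I. -/
variable {E : Type*} [AddCommGroup E] [Module ℝ E]

theorem statement18 (b : E →ₗ[ℝ] E →ₗ[ℝ] E) (I : E →ₗ[ℝ] E) :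
    ∀ X Y : E,
      torsion (deform b I) I X Y =
        torsion b I (I X) Y + torsion b I X (I Y) - I (torsion b I X Y) := by
  intro X Y
  simp only [torsion, deform_apply, map_add, map_sub]
  abel
end
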